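/- Let A be a po-semiring satisfying condition (C2) and containing no infinite set of orthogonal idempotents. Then every idempotent element of A has an orthogonal idempotent complement (for each idempotent e there is an idempotent f with e + f = 1 and e·f = 0); in particular every idempotent e with e ≠ 0 and e ≠ 1 is a zero divisor. Furthermore, every nonzero idempotent of A is a finite sum of pairwise orthogonal primitive idempotents. -/

import Mathlib

/-- A po-semiring: a commutative semiring equipped with a compatible partial order
such that 0 is the least and 1 is the greatest element. -/
class PoSemiring (A : Type*) extends CommSemiring A, PartialOrder A where
  add_right_mono : ∀ x y z : A, x ≤ y → x + z ≤ y + z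
  mul_left_mono : ∀ x y z : A, (0 : A) ≤ x → y ≤ z → x * y ≤ x * z
  zero_le_elem : ∀ x : A, (0 : A) ≤ x
  le_one_elem : ∀ x : A, x ≤ (1 : A)

/-- A maximal element of a po-semiring. -/
def IsMaximalElem {A : Type*} [PoSemiring A] (m : A) : Prop :=
  m ≠ 1 ∧ ∀ x : A, m ≤ x → x < 1 → m = x

/-- A prime element of a po-semiring. -/
def IsPrimeElem {A : Type*} [PoSemiring A] (p : A) : Prop :=
  p ≠ 1 ∧ ∀ x y : A, x * y ≤ p → x ≤ p ∨ y ≤ p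

/-- The set `Z(A)` of nonzero zero divisors of a po-semiring. -/
def zdSet (A : Type*) [PoSemiring A] : Set A :=
  {a | a ≠ 0 ∧ ∃ b : A, b ≠ 0 ∧ a * b = 0}

/-- Condition (C1): each non-nilpotent element lies above a nonzero idempotent
having an orthogonal idempotent complement. -/
def CondC1 (A : Type*) [PoSemiring A] : Prop :=
  ∀ u : A, ¬ IsNilpotent u →
    ∃ w v : A, w ≠ 0 ∧ w * w = w ∧ v * v = v ∧ w ≤ u ∧ w + v = 1 ∧ w * v = 0

/-- Condition (C2): each nonzero idempotent lies above a nonzero idempotent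
having an orthogonal idempotent complement. -/
def CondC2 (A : Type*) [PoSemiring A] : Prop :=
  ∀ u : A, u ≠ 0 → u * u = u →
    ∃ w v : A, w ≠ 0 ∧ w * w = w ∧ v * v = v ∧ w ≤ u ∧ w + v = 1 ∧ w * v = 0

/-- `A` contains no infinite set of orthogonal idempotents. -/
def NoInfiniteOrthogonalIdempotents (A : Type*) [PoSemiring A] : Prop :=
  ∀ S : Set A, (∀ e ∈ S, e ≠ 0 ∧ e * e = e) →
    (∀ e ∈ S, ∀ f ∈ S, e ≠ f → e * f = 0) → S.Finite

/-- DCC for elements: no infinite strictly descending chain. -/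
def ElemDCC (A : Type*) [PoSemiring A] : Prop :=
  ¬ ∃ f : ℕ → A, ∀ n : ℕ, f (n + 1) < f n

/-- ACC for elements: no infinite strictly ascending chain. -/
def ElemACC (A : Type*) [PoSemiring A] : Prop :=
  ¬ ∃ f : ℕ → A, ∀ n : ℕ, f n < f (n + 1)

/-- A primitive idempotent: a nonzero idempotent which is not the sum of
two orthogonal nonzero idempotents. -/
def IsPrimitiveIdem {A : Type*} [PoSemiring A] (e : A) : Prop :=
  e ≠ 0 ∧ e * e = e ∧
    ¬ ∃ f g : A, f ≠ 0 ∧ g ≠ 0 ∧ f * f = f ∧ g * g = g ∧ f * g = 0 ∧ e = f + g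

theorem descent_aux {A : Type*} [PoSemiring A]
    (horth : NoInfiniteOrthogonalIdempotents A) (P : A → Prop)
    (hP : ∀ e : A, P e → e * e = e ∧ ∃ w e' : A, w ≠ 0 ∧ w * w = w ∧ w * e' = 0 ∧
      e = w + e' ∧ P e') (e : A) : ¬ P e := by
  intro he
  choose h1 W E hW0 hWW hWE hE hPE using hP
  let s : ℕ → {x : A // P x} := fun n => Nat.rec ⟨e, he⟩ (fun _ x => ⟨E x.1 x.2, hPE x.1 x.2⟩) n
  let w : ℕ → A := fun n => W (s n).1 (s n).2
  have hs : ∀ n, (s n).1 = w n + (s (n+1)).1 := fun n => hE _ _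
  have hws : ∀ n, w n * (s (n+1)).1 = 0 := fun n => hWE _ _
  have hw0 : ∀ n, w n ≠ 0 := fun n => hW0 _ _
  have hww : ∀ n, w n * w n = w n := fun n => hWW _ _
  have hss : ∀ n, (s n).1 * (s n).1 = (s n).1 := fun n => h1 _ (s n).2
  have hsw : ∀ n, (s n).1 * w n = w n := by
    intro n
    rw [hs n, add_mul, hww, mul_comm _ (w n), hws, add_zero]
  have hstep : ∀ n, (s n).1 * (s (n+1)).1 = (s (n+1)).1 := by
    intro n
    rw [hs n, add_mul, hws, zero_add]
    exact hss (n+1)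
  have hle : ∀ n m, n ≤ m → (s n).1 * (s m).1 = (s m).1 := by
    intro n m h
    induction m, h using Nat.le_induction with
    | base => exact hss n
    | succ m _ ih => rw [← hstep m, ← mul_assoc, ih]
  have hlt : ∀ n m, n < m → w n * w m = 0 := by
    intro n m h
    rw [← hsw m, ← hle (n+1) m h, ← mul_assoc, ← mul_assoc, hws, zero_mul, zero_mul]
  have hne : ∀ n m, n ≠ m → w n * w m = 0 := by
    intro n m h
    rcases lt_or_gt_of_ne h with h | h
    · exact hlt _ _ h
    · rw [mul_comm]; exact hlt _ _ h
  have hinj : Function.Injective w := by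
    intro n m h
    by_contra hnm
    have := hne n m hnm
    rw [← h, hww] at this
    exact hw0 n this
  refine Set.infinite_range_of_injective hinj (horth (Set.range w) ?_ ?_)
  · rintro _ ⟨n, rfl⟩
    exact ⟨hw0 n, hww n⟩
  · rintro _ ⟨n, rfl⟩ _ ⟨m, rfl⟩ h
    exact hne n m (fun h' => h (by rw [h']))

def IsPrimSum {A : Type*} [PoSemiring A] (e : A) : Prop :=
  ∃ (n : ℕ) (g : Fin n → A), (∀ i, IsPrimitiveIdem (g i)) ∧
        (∀ i j, i ≠ j → g i * g j = 0) ∧ e = ∑ i, g i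

theorem IsPrimSum.add {A : Type*} [PoSemiring A] {e f : A} (he : IsPrimSum e)
    (hf : IsPrimSum f) (hef : e * f = 0) : IsPrimSum (e + f) := by
  obtain ⟨n, g, hg, hgo, rfl⟩ := he
  obtain ⟨m, k, hk, hko, rfl⟩ := hf
  have h1 : ∀ i, g i * ∑ j, g j = g i := by
    intro i
    rw [Finset.mul_sum, Finset.sum_eq_single i, (hg i).2.1]
    · intro j _ h
      exact hgo _ _ h.symm
    · simp
  have h2 : ∀ i, (∑ j, k j) * k i = k i := by
    intro i
    rw [Finset.sum_mul, Finset.sum_eq_single i, (hk i).2.1]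
    · intro j _ h
      exact hko _ _ h
    · simp
  have h3 : ∀ i j, g i * k j = 0 := by
    intro i j
    rw [← h1 i, ← h2 j, mul_assoc, ← mul_assoc (∑ j, g j), hef, zero_mul, mul_zero]
  refine ⟨n + m, Fin.append g k, ?_, ?_, ?_⟩
  · intro i
    refine Fin.addCases (fun i => ?_) (fun i => ?_) i
    · simpa using hg i
    · simpa using hk i
  · intro i j
    refine Fin.addCases (fun i => ?_) (fun i => ?_) i <;>
      refine Fin.addCases (fun j => ?_) (fun j => ?_) j <;> intro h
    · simpa using hgo i j (fun h' => h (by rw [h']))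
    · simpa using h3 i j
    · simpa [mul_comm] using h3 j i
    · simpa using hko i j (fun h' => h (by rw [h']))
  · simp [Fin.sum_univ_add]

theorem idempotents_of_condC2 {A : Type*} [PoSemiring A] [Nontrivial A]
    (hC2 : CondC2 A) (horth : NoInfiniteOrthogonalIdempotents A) :
    (∀ e : A, e * e = e → ∃ f : A, f * f = f ∧ e + f = 1 ∧ e * f = 0) ∧
    (∀ e : A, e * e = e → e ≠ 0 → e ≠ 1 → e ∈ zdSet A) ∧
    (∀ e : A, e * e = e → e ≠ 0 →
      ∃ (n : ℕ) (g : Fin n → A), (∀ i, IsPrimitiveIdem (g i)) ∧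
        (∀ i j, i ≠ j → g i * g j = 0) ∧ e = ∑ i, g i) := by
  have H1 : ∀ e : A, e * e = e → ∃ f : A, f * f = f ∧ e + f = 1 ∧ e * f = 0 := by
    intro e he
    by_contra hcon
    refine descent_aux horth (fun e => e * e = e ∧
      ¬ ∃ f : A, f * f = f ∧ e + f = 1 ∧ e * f = 0) ?_ e ⟨he, hcon⟩
    clear he hcon e
    rintro e ⟨he, hcon⟩
    refine ⟨he, ?_⟩
    have he0 : e ≠ 0 := by
      rintro rfl
      exact hcon ⟨1, by simp⟩
    obtain ⟨w, v, hw0, hww, hvv, hwe, hwv, hwv0⟩ := hC2 e he0 he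
    have hew : w * e = w := by
      apply le_antisymm
      · simpa using PoSemiring.mul_left_mono w e 1 (PoSemiring.zero_le_elem w)
          (PoSemiring.le_one_elem e)
      · simpa [hww] using PoSemiring.mul_left_mono w w e (PoSemiring.zero_le_elem w) hwe
    have hsum : e = w + v * e := by
      calc e = (w + v) * e := by rw [hwv, one_mul]
        _ = w + v * e := by rw [add_mul, hew]
    refine ⟨w, v * e, hw0, hww, by rw [← mul_assoc, hwv0, zero_mul], hsum, ?_, ?_⟩
    · rw [mul_mul_mul_comm, hvv, he]
    · rintro ⟨f, hff, h1, h0⟩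
      refine hcon ⟨v * f, by rw [mul_mul_mul_comm, hvv, hff], ?_, ?_⟩
      · calc e + v * f = w + v * v * e + v * f := by rw [hvv, ← hsum]
          _ = w + v * (v * e + f) := by ring
          _ = 1 := by rw [h1, mul_one, hwv]
      · rw [← h0]; ring
  refine ⟨H1, ?_, ?_⟩
  · intro e he h0 h1
    obtain ⟨f, _, hef, hef0⟩ := H1 e he
    refine ⟨h0, f, ?_, hef0⟩
    rintro rfl
    exact h1 (by simpa using hef)
  · intro e he h0
    by_contra hcon
    refine descent_aux horth (fun e => e * e = e ∧ e ≠ 0 ∧ ¬ IsPrimSum e) ?_ e ⟨he, h0, hcon⟩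
    clear he hcon h0 e
    rintro e ⟨he, h0, hcon⟩
    refine ⟨he, ?_⟩
    have hnp : ¬ IsPrimitiveIdem e := fun hp =>
      hcon ⟨1, fun _ => e, fun _ => hp, fun i j h => (h (Subsingleton.elim _ _)).elim, by simp⟩
    have : ∃ f g : A, f ≠ 0 ∧ g ≠ 0 ∧ f * f = f ∧ g * g = g ∧ f * g = 0 ∧ e = f + g := by
      by_contra h
      exact hnp ⟨h0, he, h⟩
    obtain ⟨f, g, hf0, hg0, hff, hgg, hfg, rfl⟩ := this
    by_cases hf : IsPrimSum f
    · exact ⟨f, g, hf0, hff, hfg, rfl, hgg, hg0, fun hg => hcon (hf.add hg hfg)⟩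
    · exact ⟨g, f, hg0, hgg, by rw [mul_comm, hfg], add_comm _ _, hff, hf0, hf⟩
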